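/- For every integer n ≥ 1, the determinant map det : U(n) → S¹ induces an isomorphism of fundamental groups; in particular the fundamental group of U(n) is isomorphic to ℤ. -/

import Mathlib

open scoped FundamentalGroupoid

/-- The homomorphism induced on fundamental groups by a continuous map. -/
noncomputable def inducedPi1 {X Y : Type} [TopologicalSpace X] [TopologicalSpace Y]
    (f : C(X, Y)) (x : X) :
    FundamentalGroup X x →* FundamentalGroup Y (f x) :=
  let F : TopCat.of X ⟶ TopCat.of Y := TopCat.ofHom f
  (πₘ F).mapEnd (FundamentalGroupoid.mk x)

/-- The determinant of a unitary matrix, as an element of the circle group. -/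
noncomputable def detCircle (n : ℕ) (u : Matrix.unitaryGroup (Fin n) ℂ) : Circle :=
  ⟨(u : Matrix (Fin n) (Fin n) ℂ).det, by
    have h := Matrix.det_of_mem_unitary u.prop
    have h2 := h.2
    rw [Complex.star_def, Complex.mul_conj] at h2
    have h3 : Complex.normSq (u : Matrix (Fin n) (Fin n) ℂ).det = 1 := by exact_mod_cast h2
    have : ‖(u : Matrix (Fin n) (Fin n) ℂ).det‖ = 1 := by
      rw [Complex.norm_def, h3, Real.sqrt_one]
    exact mem_sphere_zero_iff_norm.mpr this⟩

/-- The determinant map `det : U(n) → S¹`, as a continuous map. -/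
noncomputable def circleDet (n : ℕ) : C(Matrix.unitaryGroup (Fin n) ℂ, Circle) :=
  ⟨detCircle n, by
    apply Continuous.subtype_mk
    exact continuous_subtype_val.matrix_det⟩

open Matrix unitInterval in
theorem hh_mem {n : ℕ} (a : ℂ) (u : Fin n → ℂ)
    (h : a + star a = a * star a * (star u ⬝ᵥ u)) :
    (1 - a • vecMulVec u (star u)) ∈ Matrix.unitaryGroup (Fin n) ℂ := by
  rw [Matrix.mem_unitaryGroup_iff, star_eq_conjTranspose]
  have h1 : (1 - a • vecMulVec u (star u))ᴴ = 1 - star a • vecMulVec u (star u) := by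
    rw [conjTranspose_sub, conjTranspose_smul, conjTranspose_vecMulVec]; simp
  rw [h1]
  have h2 : vecMulVec u (star u) * vecMulVec u (star u) = (star u ⬝ᵥ u) • vecMulVec u (star u) := by
    rw [vecMulVec_mul_vecMulVec]; ext i j; simp [vecMulVec_apply]; ring
  have h3 : (1 - a • vecMulVec u (star u)) * (1 - star a • vecMulVec u (star u))
     = 1 - (a + star a - a * star a * (star u ⬝ᵥ u)) • vecMulVec u (star u) := by
    rw [sub_mul, mul_sub, one_mul, mul_sub, mul_one, one_mul, smul_mul_smul_comm, h2]
    module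
  rw [h3, h, sub_self, zero_smul, sub_zero]

open Matrix in
noncomputable def rot {n : ℕ} (v w : Fin n → ℂ) : Matrix (Fin n) (Fin n) ℂ :=
  (1 - (1 + star w ⬝ᵥ v)⁻¹ • vecMulVec (v + w) (star (v + w))) *
    (1 - (2 : ℂ) • vecMulVec v (star v))

open Matrix in
theorem dot_star {n : ℕ} (v w : Fin n → ℂ) : star (star v ⬝ᵥ w) = star w ⬝ᵥ v := by
  rw [Matrix.star_dotProduct, star_star]

open Matrix in
theorem rot_mem {n : ℕ} {v w : Fin n → ℂ} (hv : star v ⬝ᵥ v = 1) (hw : star w ⬝ᵥ w = 1)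
    (h : 1 + star w ⬝ᵥ v ≠ 0) : rot v w ∈ Matrix.unitaryGroup (Fin n) ℂ := by
  refine mul_mem (hh_mem _ _ ?_) (hh_mem _ _ ?_)
  · have h' : 1 + star v ⬝ᵥ w ≠ 0 := by
      intro h0; apply h
      rw [← dot_star, ← star_one, ← star_add, h0, star_zero]
    rw [star_inv₀, star_add, star_one, dot_star, star_add, add_dotProduct, dotProduct_add,
      dotProduct_add, hv, hw]
    field_simp
    ring
  · rw [hv]; norm_num

open Matrix in
theorem rot_apply {n : ℕ} {v w : Fin n → ℂ} (hv : star v ⬝ᵥ v = 1) 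
    (h : 1 + star w ⬝ᵥ v ≠ 0) : rot v w *ᵥ v = w := by
  have e1 : (1 - (2 : ℂ) • vecMulVec v (star v)) *ᵥ v = -v := by
    rw [sub_mulVec, one_mulVec, smul_mulVec, vecMulVec_mulVec, hv]
    simp; module
  rw [rot, ← mulVec_mulVec, e1, mulVec_neg, sub_mulVec, one_mulVec, smul_mulVec, vecMulVec_mulVec,
    star_add, add_dotProduct, hv]
  ext i
  simp
  field_simp
  ring

open Matrix in
theorem rot_self {n : ℕ} {v : Fin n → ℂ} (hv : star v ⬝ᵥ v = 1) : rot v v = 1 := by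
  have e : (1 - (1 + star v ⬝ᵥ v)⁻¹ • vecMulVec (v + v) (star (v + v))) =
    (1 - (2 : ℂ) • vecMulVec v (star v)) := by
    rw [hv]; ext i j; simp [vecMulVec_apply]; ring
  have h2 : vecMulVec v (star v) * vecMulVec v (star v) = vecMulVec v (star v) := by
    rw [vecMulVec_mul_vecMulVec, hv]; ext i j; simp [vecMulVec_apply]
  rw [rot, e, sub_mul, mul_sub, one_mul, mul_sub, mul_one, one_mul, smul_mul_smul_comm, h2]
  module

open Matrix in
theorem rot_fix {n : ℕ} {v w x : Fin n → ℂ} (hv : star v ⬝ᵥ x = 0) (hw : star w ⬝ᵥ x = 0) :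
    rot v w *ᵥ x = x := by
  have e1 : (1 - (2 : ℂ) • vecMulVec v (star v)) *ᵥ x = x := by
    rw [sub_mulVec, one_mulVec, smul_mulVec, vecMulVec_mulVec, hv]
    simp
  rw [rot, ← mulVec_mulVec, e1, sub_mulVec, one_mulVec, smul_mulVec, vecMulVec_mulVec,
    star_add, add_dotProduct, hv, hw]
  simp

open Matrix in
theorem rot_cont {n : ℕ} {X : Type*} [TopologicalSpace X] {f g : X → Fin n → ℂ}
    (hf : Continuous f) (hg : Continuous g) (h : ∀ x, 1 + star (g x) ⬝ᵥ f x ≠ 0) :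
    Continuous fun x => rot (f x) (g x) := by
  have h1 : Continuous fun x => (1 + star (g x) ⬝ᵥ f x)⁻¹ := by
    refine Continuous.inv₀ ?_ h
    exact continuous_const.add (hg.star.dotProduct hf)
  unfold rot
  refine Continuous.mul ?_ ?_
  · exact continuous_const.sub (h1.smul ((hf.add hg).matrix_vecMulVec (hf.add hg).star))
  · exact continuous_const.sub ((hf.matrix_vecMulVec hf.star).const_smul (2 : ℂ))

/-- Euclidean length. -/
noncomputable def vlen {n : ℕ} (w : Fin n → ℂ) : ℝ := Real.sqrt (∑ i, ‖w i‖ ^ 2)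

/-- Normalization. -/
noncomputable def vnrm {n : ℕ} (w : Fin n → ℂ) : Fin n → ℂ := ((vlen w)⁻¹ : ℝ) • w

open Matrix in
theorem dot_self {n : ℕ} (w : Fin n → ℂ) : star w ⬝ᵥ w = ((vlen w ^ 2 : ℝ) : ℂ) := by
  rw [vlen, Real.sq_sqrt (by positivity)]
  simp only [dotProduct, Pi.star_apply, Complex.star_def, Complex.conj_mul']
  push_cast; rfl

theorem vlen_ne {n : ℕ} {w : Fin n → ℂ} (h : w ≠ 0) : vlen w ≠ 0 := by
  intro h0
  apply h
  rw [vlen, Real.sqrt_eq_zero (by positivity),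
    Finset.sum_eq_zero_iff_of_nonneg (fun i _ => by positivity)] at h0
  ext i
  simpa using h0 i (Finset.mem_univ i)

open Matrix in
theorem vnrm_dot {n : ℕ} {w : Fin n → ℂ} (h : w ≠ 0) : star (vnrm w) ⬝ᵥ vnrm w = 1 := by
  have := vlen_ne h
  simp only [vnrm, star_smul, smul_dotProduct, dotProduct_smul, dot_self]
  simp only [star_trivial, Complex.real_smul]
  norm_cast
  field_simp

theorem vnrm_cont {n : ℕ} {X : Type*} [TopologicalSpace X] {f : X → Fin n → ℂ}
    (hf : Continuous f) (h : ∀ x, f x ≠ 0) : Continuous fun x => vnrm (f x) := by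
  have : Continuous fun x => vlen (f x) := by unfold vlen; fun_prop
  exact (this.inv₀ fun x => vlen_ne (h x)).smul hf

open Matrix in
theorem vnrm_unit {n : ℕ} {w : Fin n → ℂ} (h : star w ⬝ᵥ w = 1) : vnrm w = w := by
  rw [dot_self] at h
  have h2 : vlen w ^ 2 = 1 := by exact_mod_cast h
  have h3 : vlen w = 1 := by
    have : 0 ≤ vlen w := Real.sqrt_nonneg _
    nlinarith
  simp [vnrm, h3]

open Matrix in
theorem rot_ok {n : ℕ} {v w : Fin n → ℂ} (hv : star v ⬝ᵥ v = 1) (hw : star w ⬝ᵥ w = 1)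
    (h : w ≠ -v) : 1 + star w ⬝ᵥ v ≠ 0 := by
  intro h0
  have h1 : star w ⬝ᵥ v = -1 := by linear_combination h0
  have h2 : star v ⬝ᵥ w = -1 := by rw [← dot_star, h1]; simp
  apply h
  rw [eq_neg_iff_add_eq_zero]
  by_contra h3
  have h4 := dot_self (w + v)
  rw [star_add, add_dotProduct, dotProduct_add, dotProduct_add, hv, hw, h1, h2] at h4
  have h5 : (vlen (w + v) ^ 2 : ℝ) = 0 := by
    have : ((vlen (w + v) ^ 2 : ℝ) : ℂ) = 0 := by rw [← h4]; norm_num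
    exact_mod_cast this
  exact vlen_ne h3 (pow_eq_zero_iff two_ne_zero |>.1 h5)

open Matrix in
theorem uni_dot {n : ℕ} (u : Matrix.unitaryGroup (Fin n) ℂ) (x y : Fin n → ℂ) :
    star (u.1 *ᵥ x) ⬝ᵥ (u.1 *ᵥ y) = star x ⬝ᵥ y := by
  rw [star_mulVec, dotProduct_mulVec, vecMul_vecMul, ← star_eq_conjTranspose,
    Matrix.mem_unitaryGroup_iff'.1 u.2, vecMul_one]

open Matrix unitInterval in
theorem move {n : ℕ} (γ : C(I, Matrix.unitaryGroup (Fin n) ℂ)) (hγ : γ 0 = γ 1)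
    (e : Fin n → ℂ) (he : star e ⬝ᵥ e = 1) (w : I → Fin n → ℂ) (hwc : Continuous w)
    (hw : w 0 = w 1) (hne : ∀ t, ∀ c : ℝ, 0 ≤ c → w t ≠ -(c • ((γ t).1 *ᵥ e))) :
    ∃ γ' : C(I, Matrix.unitaryGroup (Fin n) ℂ),
      ContinuousMap.HomotopicWith γ γ' (fun f => f 0 = f 1) ∧
      (∀ t, (γ' t).1 *ᵥ e = vnrm (w t)) ∧
      (∀ t x, (γ t).1 *ᵥ x = x → star e ⬝ᵥ x = 0 → star (w t) ⬝ᵥ x = 0 → (γ' t).1 *ᵥ x = x) := by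
  let v : I → Fin n → ℂ := fun t => (γ t).1 *ᵥ e
  have hvc : Continuous v :=
    Continuous.matrix_mulVec (continuous_subtype_val.comp γ.continuous) continuous_const
  have hv1 : ∀ t, star (v t) ⬝ᵥ v t = 1 := fun t => by
    simp only [v]; rw [uni_dot, he]
  have hv0 : ∀ t, v t ≠ 0 := fun t h => by simpa [h] using hv1 t
  let z : I × I → Fin n → ℂ := fun p => (1 - p.1 : ℝ) • v p.2 + (p.1 : ℝ) • w p.2
  have hzc : Continuous z := by
    have := hvc.comp (continuous_snd (X := I) (Y := I))
    have := hwc.comp (continuous_snd (X := I) (Y := I))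
    simp only [z]
    fun_prop
  have key : ∀ p, ∀ c : ℝ, 0 ≤ c → z p ≠ -(c • v p.2) := by
    rintro ⟨s, t⟩ c hc h
    simp only [z] at h
    have h1 : (s : ℝ) • w t = -((c + (1 - s : ℝ)) • v t) := by
      rw [add_smul]; rw [← eq_sub_iff_add_eq'] at h; rw [h]; module
    have hs1 := s.2.2
    have hs0 := s.2.1
    rcases eq_or_lt_of_le hs0 with h0 | h0
    · rw [← h0, zero_smul, eq_comm, neg_eq_zero, smul_eq_zero] at h1
      rcases h1 with h1 | h1
      · linarith
      · exact hv0 t h1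
    · have h2 : 0 ≤ 1 - (s : ℝ) := by linarith
      refine hne t ((s : ℝ)⁻¹ * (c + (1 - s : ℝ))) (by positivity) ?_
      rw [mul_smul, ← smul_neg, ← h1, smul_smul, inv_mul_cancel₀ h0.ne', one_smul]
  have hz0 : ∀ p, z p ≠ 0 := fun p h => key p 0 le_rfl (by simpa using h)
  have hok : ∀ p, 1 + star (vnrm (z p)) ⬝ᵥ v p.2 ≠ 0 := by
    intro p
    refine rot_ok (hv1 _) (vnrm_dot (hz0 p)) ?_
    intro h
    refine key p (vlen (z p)) (Real.sqrt_nonneg _) ?_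
    rw [← smul_neg, ← h, vnrm, smul_smul, mul_inv_cancel₀ (vlen_ne (hz0 p)), one_smul]
  let H : C(I × I, Matrix.unitaryGroup (Fin n) ℂ) :=
    ⟨fun p => ⟨rot (v p.2) (vnrm (z p)), rot_mem (hv1 _) (vnrm_dot (hz0 p)) (hok p)⟩ * γ p.2, by
      refine Continuous.mul ?_ (γ.continuous.comp continuous_snd)
      exact Continuous.subtype_mk (rot_cont (hvc.comp continuous_snd) (vnrm_cont hzc hz0) hok) _⟩
  have hH : ∀ p, (H p).1 = rot (v p.2) (vnrm (z p)) * (γ p.2).1 := fun p => rfl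
  have hz1 : ∀ t, z (1, t) = w t := fun t => by simp [z]
  refine ⟨H.comp ⟨fun t => (1, t), by fun_prop⟩, ⟨⟨⟨H, ?_, ?_⟩, ?_⟩⟩, ?_, ?_⟩
  · intro t
    apply Subtype.ext
    have : z (0, t) = v t := by simp [z]
    show (H (0, t)).1 = _
    rw [hH, this, vnrm_unit (hv1 t), rot_self (hv1 t), one_mul]
  · intro t; rfl
  · intro s
    show H (s, 0) = H (s, 1)
    apply Subtype.ext
    have e1 : v 0 = v 1 := by simp only [v]; rw [hγ]
    rw [hH, hH]
    simp only [z, e1, hw, hγ]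
  · intro t
    show (H (1, t)).1 *ᵥ e = _
    rw [hH, ← mulVec_mulVec]
    show rot (v t) _ *ᵥ v t = _
    rw [rot_apply (hv1 t) (hok (1, t)), hz1]
  · intro t x hx hex hwx
    show (H (1, t)).1 *ᵥ x = _
    rw [hH, ← mulVec_mulVec, hx]
    apply rot_fix
    · rw [← hx]; simp only [v]; rw [uni_dot, hex]
    · rw [hz1, vnrm, star_smul, smul_dotProduct, hwx, smul_zero]

open unitInterval in
theorem smooth_real (f : I → ℝ) (hf : Continuous f) (ε : ℝ) (hε : 0 < ε) :
    ∃ g : ℝ → ℝ, ContDiff ℝ 1 g ∧ g 0 = f 0 ∧ g 1 = f 1 ∧ ∀ t : I, |g t - f t| < ε := by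
  obtain ⟨p, hp⟩ := exists_polynomial_near_of_continuousOn 0 1 (Set.IccExtend zero_le_one f)
    (hf.Icc_extend').continuousOn (ε / 3) (by positivity)
  have hp' : ∀ t : I, |p.eval (t : ℝ) - f t| < ε / 3 := fun t => by
    have := hp t t.2
    rwa [Set.IccExtend_val] at this
  refine ⟨fun x => p.eval x + ((1 - x) * (f 0 - p.eval 0) + x * (f 1 - p.eval 1)), ?_, by simp,
    by simp, ?_⟩
  · have : ContDiff ℝ 1 fun x : ℝ => p.eval x := by
      simpa using p.contDiff_aeval (𝕜 := ℝ) 1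
    fun_prop
  · intro t
    have h0 := hp' 0
    have h1 := hp' 1
    have ht := hp' t
    simp only [Set.Icc.coe_zero, Set.Icc.coe_one] at h0 h1
    have ht0 := t.2.1
    have ht1 := t.2.2
    rw [abs_lt] at *
    constructor <;> nlinarith

open unitInterval in
theorem smooth_cplx (f : I → ℂ) (hf : Continuous f) (ε : ℝ) (hε : 0 < ε) :
    ∃ g : ℝ → ℂ, ContDiff ℝ 1 g ∧ g 0 = f 0 ∧ g 1 = f 1 ∧ ∀ t : I, ‖g t - f t‖ < ε := by
  obtain ⟨a, ha, ha0, ha1, hat⟩ := smooth_real (fun t => (f t).re)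
    (Complex.continuous_re.comp hf) (ε / 2) (by positivity)
  obtain ⟨b, hb, hb0, hb1, hbt⟩ := smooth_real (fun t => (f t).im)
    (Complex.continuous_im.comp hf) (ε / 2) (by positivity)
  refine ⟨fun x => (a x : ℂ) + (b x : ℂ) * Complex.I, ?_, ?_, ?_, ?_⟩
  · have h1 := Complex.ofRealCLM.contDiff (n := 1) |>.comp ha
    have h2 := Complex.ofRealCLM.contDiff (n := 1) |>.comp hb
    exact h1.add (h2.mul contDiff_const)
  · apply Complex.ext <;> simp [ha0, hb0]
  · apply Complex.ext <;> simp [ha1, hb1]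
  · intro t
    refine (Complex.norm_le_abs_re_add_abs_im _).trans_lt ?_
    have := hat t
    have := hbt t
    simp
    linarith

theorem exists_avoid (g₁ g₂ : ℝ → ℂ) (h₁ : ContDiff ℝ 1 g₁) (h₂ : ContDiff ℝ 1 g₂) :
    ∃ q : ℂ × ℂ, q.2 ≠ 0 ∧ ∀ (c t : ℝ), q.1 = c * g₁ t → q.2 = c * g₂ t → False := by
  have hd : Dense (Set.range fun p : ℝ × ℝ => ((p.1 • g₁ p.2, p.1 • g₂ p.2) : ℂ × ℂ))ᶜ := by
    apply ContDiff.dense_compl_range_of_finrank_lt_finrank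
    · have := h₁.comp (contDiff_snd (E := ℝ) (F := ℝ))
      have := h₂.comp (contDiff_snd (E := ℝ) (F := ℝ))
      exact (contDiff_fst.smul ‹ContDiff ℝ 1 (g₁ ∘ Prod.snd)›).prodMk (contDiff_fst.smul this)
    · simp
  obtain ⟨q, hq, hq2⟩ := hd.inter_open_nonempty {q : ℂ × ℂ | q.2 ≠ 0}
    (isOpen_ne_fun continuous_snd continuous_const) ⟨(0, 1), one_ne_zero⟩
  refine ⟨q, hq, fun c t e1 e2 => hq2 ⟨(c, t), ?_⟩⟩
  simp only [Complex.real_smul]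
  rw [← e1, ← e2]

open Matrix in
theorem entry_le {n : ℕ} (v : Fin n → ℂ) (hv : star v ⬝ᵥ v = 1) (i : Fin n) : ‖v i‖ ≤ 1 := by
  rw [dot_self] at hv
  have h2 : vlen v ^ 2 = 1 := by exact_mod_cast hv
  rw [vlen, Real.sq_sqrt (by positivity)] at h2
  have := Finset.single_le_sum (f := fun i => ‖v i‖ ^ 2) (fun i _ => by positivity)
    (Finset.mem_univ i)
  simp only [h2] at this
  nlinarith [norm_nonneg (v i)]

open Matrix unitInterval in
theorem step {n : ℕ} (γ : C(I, Matrix.unitaryGroup (Fin n) ℂ)) (hγ : γ 0 = γ 1)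
    (k k' : Fin n) (hk : k < k')
    (hfix : ∀ t, ∀ i, i < k → (γ t).1 *ᵥ Pi.single i 1 = Pi.single i 1) :
    ∃ γ' : C(I, Matrix.unitaryGroup (Fin n) ℂ),
      ContinuousMap.HomotopicWith γ γ' (fun f => f 0 = f 1) ∧
      ∀ t, ∀ i, i ≤ k → (γ' t).1 *ᵥ Pi.single i 1 = Pi.single i 1 := by
  let e : Fin n → ℂ := Pi.single k 1
  have he : star e ⬝ᵥ e = 1 := by simp [e]
  let v : I → Fin n → ℂ := fun t => (γ t).1 *ᵥ e
  have hvc : Continuous v :=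
    Continuous.matrix_mulVec (continuous_subtype_val.comp γ.continuous) continuous_const
  have hv1 : ∀ t, star (v t) ⬝ᵥ v t = 1 := fun t => by
    simp only [v]; rw [uni_dot, he]
  have hv01 : v 0 = v 1 := by simp only [v]; rw [hγ]
  have hek : ∀ i, i < k → star e ⬝ᵥ Pi.single i 1 = 0 := fun i hi => by
    simp [e, Pi.single_apply, hi.ne]
  have hvk : ∀ t i, i < k → star (v t) ⬝ᵥ Pi.single i 1 = 0 := fun t i hi => by
    rw [← hfix t i hi]; simp only [v]; rw [uni_dot, hek i hi]
  obtain ⟨g₁, hg₁, hg₁0, hg₁1, hg₁t⟩ := smooth_cplx (fun t => v t k)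
    ((continuous_apply k).comp hvc) (1/2) (by norm_num)
  obtain ⟨g₂, hg₂, hg₂0, hg₂1, hg₂t⟩ := smooth_cplx (fun t => v t k')
    ((continuous_apply k').comp hvc) (1/2) (by norm_num)
  obtain ⟨q, hq0, hq⟩ := exists_avoid g₁ g₂ hg₁ hg₂
  let w : I → Fin n → ℂ := fun t =>
    v t + ((g₁ t - v t k) • Pi.single k 1 + (g₂ t - v t k') • Pi.single k' 1)
  have hwk : ∀ t, w t k = g₁ t := fun t => by simp [w, Pi.single_apply, hk.ne]
  have hwk' : ∀ t, w t k' = g₂ t := fun t => by simp [w, Pi.single_apply, hk.ne']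
  have hwc : Continuous w := by
    have h1 := hg₁.continuous.comp (continuous_subtype_val (p := (· ∈ I)))
    have h2 := hg₂.continuous.comp (continuous_subtype_val (p := (· ∈ I)))
    have h3 := (continuous_apply k).comp hvc
    have h4 := (continuous_apply k').comp hvc
    exact hvc.add (((h1.sub h3).smul continuous_const).add ((h2.sub h4).smul continuous_const))
  have hw01 : w 0 = w 1 := by
    simp [w, hv01, hg₁0, hg₁1, hg₂0, hg₂1]
  have hwv : ∀ t, ∀ c : ℝ, 0 ≤ c → w t ≠ -(c • v t) := by
    intro t c hc h
    have h1 : star (v t) ⬝ᵥ w t = -c := by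
      rw [h, dotProduct_neg, dotProduct_smul, hv1]; simp
    have h2 : star (v t) ⬝ᵥ w t = 1 + ((g₁ t - v t k) * star (v t k) +
        (g₂ t - v t k') * star (v t k')) := by
      simp only [w]
      rw [dotProduct_add, hv1, dotProduct_add, dotProduct_smul, dotProduct_smul]
      simp
    have h3 : ((c + 1 : ℝ) : ℂ) = -((g₁ t - v t k) * star (v t k) +
        (g₂ t - v t k') * star (v t k')) := by
      push_cast
      linear_combination -(h1.symm.trans h2)
    have h4 : ‖((c + 1 : ℝ) : ℂ)‖ < 1 := by
      rw [h3, norm_neg]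
      refine (norm_add_le _ _).trans_lt ?_
      rw [norm_mul, norm_mul, norm_star, norm_star]
      have a1 := hg₁t t
      have a2 := hg₂t t
      have b1 := mul_le_of_le_one_right (norm_nonneg (g₁ t - v t k)) (entry_le _ (hv1 t) k)
      have b2 := mul_le_of_le_one_right (norm_nonneg (g₂ t - v t k')) (entry_le _ (hv1 t) k')
      linarith
    rw [Complex.norm_real, Real.norm_eq_abs, abs_of_nonneg (by linarith)] at h4
    linarith
  have hwi : ∀ t i, i < k → star (w t) ⬝ᵥ Pi.single i 1 = 0 := fun t i hi => by
    have := hvk t i hi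
    simp only [w]
    rw [star_add, add_dotProduct, this]
    simp [Pi.single_apply, hi.ne, (hi.trans hk).ne]
  obtain ⟨γ₁, hh₁, he₁, hf₁⟩ := move γ hγ e he w hwc hw01 hwv
  have hγ₁ : γ₁ 0 = γ₁ 1 := by
    obtain ⟨H⟩ := hh₁
    have := H.prop 1
    simpa using this
  let p : Fin n → ℂ := q.1 • Pi.single k 1 + q.2 • Pi.single k' 1
  have hpk : p k = q.1 := by simp [p, Pi.single_apply, hk.ne]
  have hpk' : p k' = q.2 := by simp [p, Pi.single_apply, hk.ne']
  have hpi : ∀ i, i < k → star p ⬝ᵥ Pi.single i 1 = 0 := fun i hi => by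
    simp [p, Pi.single_apply, hi.ne, (hi.trans hk).ne]
  obtain ⟨γ₂, hh₂, he₂, hf₂⟩ := move γ₁ hγ₁ e he (fun _ => p) continuous_const rfl (by
    intro t c hc h
    rw [he₁, vnrm] at h
    have h1 := congrFun h k
    have h2 := congrFun h k'
    simp only [Pi.neg_apply, Pi.smul_apply, hpk, hpk', hwk, hwk', Complex.real_smul] at h1 h2
    refine hq (-(c * (vlen (w t))⁻¹)) t ?_ ?_
    · rw [h1]; push_cast; ring
    · rw [h2]; push_cast; ring)
  have hγ₂ : γ₂ 0 = γ₂ 1 := by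
    obtain ⟨H⟩ := hh₂
    have := H.prop 1
    simpa using this
  obtain ⟨γ₃, hh₃, he₃, hf₃⟩ := move γ₂ hγ₂ e he (fun _ => e) continuous_const rfl (by
    intro t c hc h
    rw [he₂, vnrm] at h
    have h2 := congrFun h k'
    have h1 := congrFun h k
    simp only [Pi.neg_apply, Pi.smul_apply, hpk, hpk', Complex.real_smul, e, Pi.single_apply,
      hk.ne', if_true, if_false] at h1 h2
    have h3 : (c : ℂ) * ((vlen p)⁻¹ : ℝ) = 0 := by
      have : (c : ℂ) * ((vlen p)⁻¹ : ℝ) * q.2 = 0 := by linear_combination h2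
      exact (mul_eq_zero.1 this).resolve_right hq0
    rw [← mul_assoc, h3] at h1
    simp at h1)
  refine ⟨γ₃, (hh₁.trans hh₂).trans hh₃, fun t i hi => ?_⟩
  rcases hi.eq_or_lt with rfl | hi
  · exact (he₃ t).trans (vnrm_unit he)
  · refine hf₃ t _ (hf₂ t _ (hf₁ t _ (hfix t i hi) ?_ ?_) ?_ ?_) ?_ ?_ <;>
      first | exact hek i hi | exact hwi t i hi | exact hpi i hi

open Matrix unitInterval in
theorem steps {m : ℕ} (γ : C(I, Matrix.unitaryGroup (Fin (m + 1)) ℂ)) (hγ : γ 0 = γ 1)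
    (k : ℕ) (hk : k ≤ m) : 
    ∃ γ' : C(I, Matrix.unitaryGroup (Fin (m + 1)) ℂ),
      ContinuousMap.HomotopicWith γ γ' (fun f => f 0 = f 1) ∧
      ∀ t, ∀ i : Fin (m + 1), i.val < k → (γ' t).1 *ᵥ Pi.single i 1 = Pi.single i 1 := by
  induction k with
  | zero => exact ⟨γ, .refl _ hγ, fun t i hi => by omega⟩
  | succ k ih =>
    obtain ⟨γ₁, h₁, hf₁⟩ := ih (by omega)
    have hγ₁ : γ₁ 0 = γ₁ 1 := by
      obtain ⟨H⟩ := h₁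
      have := H.prop 1
      simpa using this
    obtain ⟨γ₂, h₂, hf₂⟩ := step γ₁ hγ₁ ⟨k, by omega⟩ ⟨k + 1, by omega⟩
      (by simp [Fin.lt_def]) (fun t i hi => hf₁ t i hi)
    exact ⟨γ₂, h₁.trans h₂, fun t i hi => hf₂ t i (by rw [Fin.le_def]; simp; omega)⟩

theorem detCircle_mul {n : ℕ} (u v : Matrix.unitaryGroup (Fin n) ℂ) :
    circleDet n (u * v) = circleDet n u * circleDet n v := by
  apply Circle.ext
  show (u.1 * v.1).det = u.1.det * v.1.det
  rw [Matrix.det_mul]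

/-- The section of the determinant. -/
noncomputable def iotaC (m : ℕ) : C(Circle, Matrix.unitaryGroup (Fin (m + 1)) ℂ) :=
  ⟨fun z => ⟨Matrix.diagonal (fun i => if i = Fin.last m then (z : ℂ) else 1), by
    rw [Matrix.mem_unitaryGroup_iff, Matrix.star_eq_conjTranspose, Matrix.diagonal_conjTranspose,
      Matrix.diagonal_mul_diagonal, ← Matrix.diagonal_one]
    congr 1
    ext i
    by_cases h : i = Fin.last m
    · simp [h, Complex.mul_conj]
    · simp [h]⟩, by
    refine Continuous.subtype_mk (Continuous.matrix_diagonal ?_) _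
    refine continuous_pi fun i => ?_
    by_cases h : i = Fin.last m
    · simp only [h, if_true]; exact continuous_subtype_val
    · simp only [h, if_false]; exact continuous_const⟩

theorem iotaC_val {m : ℕ} (z : Circle) : (iotaC m z).1 =
    Matrix.diagonal (fun i => if i = Fin.last m then (z : ℂ) else 1) := rfl

theorem det_iotaC {m : ℕ} (z : Circle) : circleDet (m + 1) (iotaC m z) = z := by
  apply Circle.ext
  show (iotaC m z).1.det = _
  rw [iotaC_val, Matrix.det_diagonal]
  simp

open Matrix in
theorem eq_iotaC {m : ℕ} (u : Matrix.unitaryGroup (Fin (m + 1)) ℂ)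
    (h : ∀ i : Fin (m + 1), i.val < m → u.1 *ᵥ Pi.single i 1 = Pi.single i 1) :
    u = iotaC m (circleDet (m + 1) u) := by
  have hd : u.1 = Matrix.diagonal
      (fun i => if i = Fin.last m then u.1 (Fin.last m) (Fin.last m) else 1) := by
    ext i j
    by_cases hj : j = Fin.last m
    · subst hj
      by_cases hi : i = Fin.last m
      · subst hi; simp
      · rw [Matrix.diagonal_apply_ne _ hi]
        have hlt : i.val < m := Fin.val_lt_last hi
        have := uni_dot u (Pi.single i 1) (Pi.single (Fin.last m) 1)
        rw [h i hlt] at this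
        simpa [Pi.single_apply, hi, Ne.symm hi] using this
    · have hlt : j.val < m := Fin.val_lt_last hj
      have := congrFun (h j hlt) i
      rw [mulVec_single_one] at this
      simp only [col_apply] at this
      rw [this]
      by_cases hij : i = j
      · subst hij; simp [hj]
      · simp [hij]
  apply Subtype.ext
  have hdet : ((circleDet (m + 1) u : Circle) : ℂ) = u.1 (Fin.last m) (Fin.last m) := by
    show u.1.det = _
    rw [hd, Matrix.det_diagonal]
    simp
  rw [iotaC_val, hdet]
  exact hd

open unitInterval in
theorem hw_comp {X Y : Type} [TopologicalSpace X] [TopologicalSpace Y] (f : C(X, Y))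
    {a b : C(I, X)} (h : a.HomotopicWith b (fun f => f 0 = f 1)) :
    (f.comp a).HomotopicWith (f.comp b) (fun f => f 0 = f 1) := by
  obtain ⟨H⟩ := h
  refine ⟨⟨⟨f.comp H.toContinuousMap, fun t => ?_, fun t => ?_⟩, fun s => ?_⟩⟩
  · exact congrArg f (H.apply_zero t)
  · exact congrArg f (H.apply_one t)
  · exact congrArg f (H.prop s)

open unitInterval in
theorem loop_eq {m : ℕ} (γ : C(I, Matrix.unitaryGroup (Fin (m + 1)) ℂ)) (hγ : γ 0 = γ 1) :
    γ.HomotopicWith ((iotaC m).comp ((circleDet (m + 1)).comp γ)) (fun f => f 0 = f 1) := by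
  obtain ⟨γ', h, hf⟩ := steps γ hγ m le_rfl
  have e : γ' = (iotaC m).comp ((circleDet (m + 1)).comp γ') := by
    ext1 t
    exact eq_iotaC _ (hf t)
  have h2 := hw_comp (iotaC m) (hw_comp (circleDet (m + 1)) h)
  rw [← e] at h2
  exact h.trans h2.symm

open unitInterval in
theorem rel_of_free {G : Type} [TopologicalSpace G] [Group G] [IsTopologicalGroup G] (u g : G)
    (γ : Path u u) (h : γ.toContinuousMap.HomotopicWith (.const I g) (fun f => f 0 = f 1)) :
    γ.Homotopic (Path.refl u) := by
  obtain ⟨H⟩ := h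
  refine ⟨⟨⟨⟨fun p => u * (H (p.1, 0))⁻¹ * H p, ?_⟩, fun t => ?_, fun t => ?_⟩, fun s t ht => ?_⟩⟩
  · have := H.continuous
    fun_prop
  · simp [H.apply_zero]
  · simp [H.apply_one]
  · have := H.prop s
    have h2 : H (s, 0) = H (s, 1) := this
    rcases ht with rfl | rfl
    · simp
    · simp [h2]

theorem pi1_inj {m : ℕ} (u : Matrix.unitaryGroup (Fin (m + 1)) ℂ) :
    Function.Injective (inducedPi1 (circleDet (m + 1)) u) := by
  rw [injective_iff_map_eq_one]
  intro a ha
  obtain ⟨γ, rfl⟩ := Path.Homotopic.Quotient.mk_surjective a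
  have h1 : (Path.Homotopic.Quotient.mk (γ.map (circleDet (m + 1)).continuous)) =
    Path.Homotopic.Quotient.mk (Path.refl (circleDet (m + 1) u)) := ha
  have h2 := Path.Homotopic.Quotient.exact h1
  refine Path.Homotopic.Quotient.eq.2 ?_
  refine rel_of_free u (iotaC m (circleDet (m + 1) u)) γ ?_
  refine (loop_eq γ.toContinuousMap (by simp)).trans ?_
  have h3 : ((circleDet (m + 1)).comp γ.toContinuousMap).HomotopicWith
      (.const _ (circleDet (m + 1) u)) (fun f => f 0 = f 1) := by
    obtain ⟨H⟩ := h2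
    refine ⟨⟨⟨H.toContinuousMap, H.apply_zero, H.apply_one⟩, fun s => ?_⟩⟩
    show H (s, 0) = H (s, 1)
    simp
  exact hw_comp (iotaC m) h3

theorem pi1_surj {m : ℕ} (u : Matrix.unitaryGroup (Fin (m + 1)) ℂ) :
    Function.Surjective (inducedPi1 (circleDet (m + 1)) u) := by
  intro a
  obtain ⟨c, rfl⟩ := Path.Homotopic.Quotient.mk_surjective a
  have h1 : iotaC m 1 = 1 := by
    apply Subtype.ext
    rw [iotaC_val]
    simp
  let γ : Path u u := 
    { toFun := fun t => u * iotaC m ((circleDet (m + 1) u)⁻¹ * c t)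
      continuous_toFun := by fun_prop
      source' := by simp [h1]
      target' := by simp [h1] }
  refine ⟨Path.Homotopic.Quotient.mk γ, ?_⟩
  show Path.Homotopic.Quotient.mk (γ.map (circleDet (m + 1)).continuous) = _
  congr 1
  ext1
  funext t
  show circleDet (m + 1) (u * iotaC m ((circleDet (m + 1) u)⁻¹ * c t)) = c t
  rw [detCircle_mul, det_iotaC, mul_inv_cancel_left]

theorem pi1_circle (x : Circle) : Nonempty (FundamentalGroup Circle x ≃* Multiplicative ℤ) := by
  have hx : Circle.exp (Complex.arg x) = x := Circle.exp_arg x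
  let E := Circle.isAddQuotientCoveringMap_exp.fundamentalGroupEquiv
    (⟨Complex.arg x, hx⟩ : Circle.exp ⁻¹' {x})
  let Z : AddSubgroup.zmultiples (2 * Real.pi) ≃+ ℤ := 
    (AddEquiv.ofBijective (zmultiplesHom _ (⟨2 * Real.pi, AddSubgroup.mem_zmultiples _⟩ :
      AddSubgroup.zmultiples (2 * Real.pi))) (by
      constructor
      · rw [injective_iff_map_eq_zero]
        intro a ha
        have := congrArg Subtype.val ha
        simpa [Real.pi_ne_zero] using this
      · rintro ⟨_, k, rfl⟩
        exact ⟨k, Subtype.ext (by simp)⟩)).symm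
  exact ⟨(E.trans (MulOpposite.opMulEquiv (M := Multiplicative _)).symm).trans
    (AddEquiv.toMultiplicative Z)⟩

/-- For every `n ≥ 1`, the determinant map `det : U(n) → S¹` induces an
isomorphism of fundamental groups (at any basepoint); in particular the fundamental group of
`U(n)` is isomorphic to `ℤ`. -/
theorem det_induces_iso_on_fundamentalGroup (n : ℕ) (hn : 1 ≤ n)
    (u : Matrix.unitaryGroup (Fin n) ℂ) :
    Function.Bijective (inducedPi1 (circleDet n) u) ∧
    Nonempty (FundamentalGroup (Matrix.unitaryGroup (Fin n) ℂ) u ≃* Multiplicative ℤ) := by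
  obtain ⟨m, rfl⟩ : ∃ m, n = m + 1 := ⟨n - 1, by omega⟩
  have hb : Function.Bijective (inducedPi1 (circleDet (m + 1)) u) := ⟨pi1_inj u, pi1_surj u⟩
  obtain ⟨E⟩ := pi1_circle (circleDet (m + 1) u)
  exact ⟨hb, ⟨(MulEquiv.ofBijective _ hb).trans E⟩⟩
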